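/- Let m, n ∈ ℕ, R > 0, and r, r₂, r' ∈ ℝ with r ≤ r₂ + min{0, r'}. Then there exists c > 0 (depending only on r, r₂, r', R) such that for every measurable set V ⊆ ℝ^n and all measurable functions F : ℝ^m → ℂ and G : ℝ^n → ℂ, setting W := {(ξ,η) ∈ ℝ^m × ℝ^n : η ∈ V and |ξ| < R|η|}, one has (∫∫_W ⟨(ξ,η)⟩^{2r} |F(ξ)|² |G(η)|² dξ dη)^{1/2} ≤ c · ‖⟨·⟩^{r'} F‖_{L²(ℝ^m)} · ‖⟨·⟩^{r₂} G‖_{L²(V)}, with both sides interpreted in [0,∞]. -/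

import Mathlib

open scoped ENNReal
open MeasureTheory

/-- The Japanese bracket `⟨x⟩ = (1 + |x|²)^(1/2)`. -/
noncomputable def jb {E : Type*} [NormedAddCommGroup E] (x : E) : ℝ :=
  Real.sqrt (1 + ‖x‖ ^ 2)

/-- Concatenation of `ξ ∈ ℝ^m` and `η ∈ ℝ^n` into `(ξ, η) ∈ ℝ^(m+n)`. -/
noncomputable def concatE {m n : ℕ} (ξ : EuclideanSpace ℝ (Fin m))
    (η : EuclideanSpace ℝ (Fin n)) : EuclideanSpace ℝ (Fin (m + n)) :=
  (EuclideanSpace.equiv (Fin (m + n)) ℝ).symm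
    (Fin.append (fun i => ξ i) (fun j => η j))

lemma one_le_jb {E : Type*} [NormedAddCommGroup E] (x : E) : 1 ≤ jb x :=
  Real.one_le_sqrt.2 (by nlinarith [sq_nonneg ‖x‖])

lemma jb_pos {E : Type*} [NormedAddCommGroup E] (x : E) : 0 < jb x :=
  zero_lt_one.trans_le (one_le_jb x)

lemma measurable_jb {E : Type*} [NormedAddCommGroup E] [MeasurableSpace E]
    [OpensMeasurableSpace E] : Measurable (jb : E → ℝ) := by
  unfold jb
  fun_prop

lemma norm_concatE_sq {m n : ℕ} (ξ : EuclideanSpace ℝ (Fin m)) (η : EuclideanSpace ℝ (Fin n)) :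
    ‖concatE ξ η‖ ^ 2 = ‖ξ‖ ^ 2 + ‖η‖ ^ 2 := by
  simp [EuclideanSpace.norm_sq_eq, concatE, Fin.sum_univ_add]

/-- Powers of two numbers comparable up to a factor `C` are comparable up to `C ^ |s|`. -/
lemma rpow_le_rpow_abs_mul {a b C : ℝ} (ha : 0 < a) (hb : 0 < b) (hC : 1 ≤ C)
    {s : ℝ} (hab : 0 ≤ s → a ≤ C * b) (hba : s ≤ 0 → b ≤ C * a) :
    a ^ s ≤ C ^ |s| * b ^ s := by
  have hC0 : 0 < C := zero_lt_one.trans_le hC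
  rcases le_total 0 s with hs | hs
  · rw [abs_of_nonneg hs, ← Real.mul_rpow hC0.le hb.le]
    exact Real.rpow_le_rpow ha.le (hab hs) hs
  · have h := Real.rpow_le_rpow_of_nonpos hb (hba hs) hs
    rw [Real.mul_rpow hC0.le ha.le] at h
    rw [abs_of_nonpos hs, Real.rpow_neg hC0.le]
    rwa [le_inv_mul_iff₀ (Real.rpow_pos_of_pos hC0 s)]

/-- Pointwise comparison of the weights on the cone `|ξ| < R |η|`. -/
lemma jb_concatE_rpow_le {m n : ℕ} {R : ℝ} (hR : 0 < R) {r r₂ r' : ℝ}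
    (hr : r ≤ r₂ + min 0 r') {ξ : EuclideanSpace ℝ (Fin m)} {η : EuclideanSpace ℝ (Fin n)}
    (h : ‖ξ‖ < R * ‖η‖) :
    jb (concatE ξ η) ^ (2 * r) ≤
      (1 + R) ^ (|2 * r| + |2 * r'|) * (jb ξ ^ (2 * r') * jb η ^ (2 * r₂)) := by
  have hC : 1 ≤ 1 + R := by linarith
  have hξη : ‖ξ‖ ^ 2 ≤ R ^ 2 * ‖η‖ ^ 2 := by
    rw [← mul_pow]
    exact pow_le_pow_left₀ (norm_nonneg ξ) h.le 2
  have sqrt_le_mul_sqrt {a b : ℝ} (hab : a ≤ (1 + R) ^ 2 * b) : √a ≤ (1 + R) * √b := by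
    rw [← Real.sqrt_sq (by linarith : 0 ≤ 1 + R), ← Real.sqrt_mul (sq_nonneg _)]
    exact Real.sqrt_le_sqrt hab
  have h₁ : jb (concatE ξ η) ≤ (1 + R) * jb η := by
    refine sqrt_le_mul_sqrt ?_
    rw [norm_concatE_sq]
    nlinarith [mul_nonneg hR.le (sq_nonneg ‖η‖), sq_nonneg R]
  have h₂ : jb ξ ≤ (1 + R) * jb η := by
    refine sqrt_le_mul_sqrt ?_
    nlinarith [mul_nonneg hR.le (sq_nonneg ‖η‖), sq_nonneg R, sq_nonneg ‖η‖]
  have h₃ : jb η ≤ (1 + R) * jb (concatE ξ η) := by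
    have : jb η ≤ jb (concatE ξ η) := by
      refine Real.sqrt_le_sqrt ?_
      rw [norm_concatE_sq]
      nlinarith [sq_nonneg ‖ξ‖]
    nlinarith [jb_pos (concatE ξ η)]
  have h₄ : jb η ^ (2 * min 0 r') ≤ (1 + R) ^ |2 * r'| * jb ξ ^ (2 * r') := by
    rcases le_or_gt 0 r' with hr' | hr'
    · rw [min_eq_left hr', mul_zero, Real.rpow_zero]
      exact one_le_mul_of_one_le_of_one_le (Real.one_le_rpow hC (abs_nonneg _))
        (Real.one_le_rpow (one_le_jb ξ) (by linarith))
    · rw [min_eq_right hr'.le]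
      exact rpow_le_rpow_abs_mul (jb_pos η) (jb_pos ξ) hC
        (fun hs => absurd hs (by linarith)) fun _ => h₂
  calc jb (concatE ξ η) ^ (2 * r) ≤ (1 + R) ^ |2 * r| * jb η ^ (2 * r) :=
        rpow_le_rpow_abs_mul (jb_pos _) (jb_pos η) hC (fun _ => h₁) fun _ => h₃
    _ ≤ (1 + R) ^ |2 * r| * jb η ^ (2 * min 0 r' + 2 * r₂) := by
        gcongr
        · exact one_le_jb η
        · linarith
    _ = (1 + R) ^ |2 * r| * (jb η ^ (2 * min 0 r') * jb η ^ (2 * r₂)) := by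
        rw [Real.rpow_add (jb_pos η)]
    _ ≤ (1 + R) ^ |2 * r| * ((1 + R) ^ |2 * r'| * jb ξ ^ (2 * r') * jb η ^ (2 * r₂)) := by
        have := jb_pos η
        gcongr
    _ = _ := by
        rw [Real.rpow_add (by linarith)]
        ring

theorem stmt_5 (m n : ℕ) (R : ℝ) (hR : 0 < R) (r r₂ r' : ℝ) (hr : r ≤ r₂ + min 0 r') :
    ∃ c : ℝ, 0 < c ∧
      ∀ (V : Set (EuclideanSpace ℝ (Fin n))), MeasurableSet V →
      ∀ (F : EuclideanSpace ℝ (Fin m) → ℂ) (G : EuclideanSpace ℝ (Fin n) → ℂ),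
        Measurable F → Measurable G →
        (∫⁻ η in V, ∫⁻ ξ in {ξ : EuclideanSpace ℝ (Fin m) | ‖ξ‖ < R * ‖η‖},
            ENNReal.ofReal (jb (concatE ξ η) ^ (2 * r)) * (‖F ξ‖₊ : ℝ≥0∞) ^ 2
              * (‖G η‖₊ : ℝ≥0∞) ^ 2) ^ (1 / 2 : ℝ)
          ≤ ENNReal.ofReal c
            * ((∫⁻ ξ, ENNReal.ofReal (jb ξ ^ (2 * r')) * (‖F ξ‖₊ : ℝ≥0∞) ^ 2) ^ (1 / 2 : ℝ)
              * (∫⁻ η in V, ENNReal.ofReal (jb η ^ (2 * r₂)) * (‖G η‖₊ : ℝ≥0∞) ^ 2) ^ (1 / 2 : ℝ)) := by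
  have hC : 0 < 1 + R := by linarith
  set K : ℝ := (1 + R) ^ (|2 * r| + |2 * r'|) with hK
  have hK0 : 0 < K := Real.rpow_pos_of_pos hC _
  refine ⟨K ^ (1 / 2 : ℝ), Real.rpow_pos_of_pos hK0 _, fun V hV F G hF hG => ?_⟩
  have hjbm := measurable_jb (E := EuclideanSpace ℝ (Fin m))
  have hjbn := measurable_jb (E := EuclideanSpace ℝ (Fin n))
  have hf : Measurable fun ξ => ENNReal.ofReal (jb ξ ^ (2 * r')) * (‖F ξ‖₊ : ℝ≥0∞) ^ 2 := by
    fun_prop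
  have hg : Measurable fun η => ENNReal.ofReal (jb η ^ (2 * r₂)) * (‖G η‖₊ : ℝ≥0∞) ^ 2 := by
    fun_prop
  rw [← ENNReal.ofReal_rpow_of_pos hK0, ← ENNReal.mul_rpow_of_nonneg _ _ (by norm_num),
    ← ENNReal.mul_rpow_of_nonneg _ _ (by norm_num), ← mul_assoc, ← lintegral_const_mul _ hg]
  refine ENNReal.rpow_le_rpow (setLIntegral_mono' hV fun η _ => ?_) (by norm_num)
  rw [mul_right_comm, ← lintegral_const_mul _ hf]
  refine (setLIntegral_mono' (measurableSet_lt measurable_norm measurable_const)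
    fun ξ hξ => ?_).trans (setLIntegral_le_lintegral _ _)
  have key := ENNReal.ofReal_le_ofReal (jb_concatE_rpow_le hR hr hξ)
  rw [← hK, ENNReal.ofReal_mul hK0.le,
    ENNReal.ofReal_mul (Real.rpow_nonneg (jb_pos ξ).le _)] at key
  calc _ ≤ _ := mul_le_mul_left (mul_le_mul_left key _) _
    _ = _ := by ring
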